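/- Let L be a bounded totally ordered lattice, n ≥ 1, let p : L^n → L be a weighted lattice polynomial function, let σ be a permutation of [n], and let x ∈ L^n satisfy x_{σ(1)} ≤ x_{σ(2)} ≤ … ≤ x_{σ(n)}. Setting S_σ(i) := {σ(i), σ(i+1), …, σ(n)} for i ∈ [n], S_σ(n+1) := ∅, x_{σ(n+1)} := 1, and α_p(S) := p(e_S), one has p(x) = ⋁_{i=1}^{n+1} ( α_p(S_σ(i)) ∧ x_{σ(i)} ). -/

import Mathlib

/-- Weighted lattice polynomial (w.l.p.) functions from `L^n` to `L`: the smallest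
class containing all coordinate projections and all constant functions, and closed
under pointwise `⊓` and `⊔`. -/
inductive IsWLP {L : Type*} [Lattice L] {n : ℕ} : ((Fin n → L) → L) → Prop
  | proj (k : Fin n) : IsWLP (fun x => x k)
  | const (c : L) : IsWLP (fun _ => c)
  | inf {p q : (Fin n → L) → L} : IsWLP p → IsWLP q → IsWLP (fun x => p x ⊓ q x)
  | sup {p q : (Fin n → L) → L} : IsWLP p → IsWLP q → IsWLP (fun x => p x ⊔ q x)

/-- The characteristic vector `e_S` of `S ⊆ [n]`: its `i`-th component is `1` (top)
if `i ∈ S` and `0` (bottom) otherwise. -/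
def charVec (L : Type*) [Lattice L] [BoundedOrder L] {n : ℕ} (S : Finset (Fin n)) :
    Fin n → L :=
  fun i => if i ∈ S then ⊤ else ⊥

theorem IsWLP.monotone {L : Type*} [Lattice L] {n : ℕ} {p : (Fin n → L) → L}
    (hp : IsWLP p) : Monotone p := by
  induction hp with
  | proj k => exact fun _ _ h => h k
  | const c => exact monotone_const
  | inf _ _ ihp ihq => exact ihp.inf ihq
  | sup _ _ ihp ihq => exact ihp.sup ihq

theorem charVec_mono {L : Type*} [Lattice L] [BoundedOrder L] {n : ℕ} :
    Monotone (charVec L : Finset (Fin n) → Fin n → L) := by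
  intro S T h i
  unfold charVec
  split_ifs with hS hT
  · exact le_rfl
  · exact absurd (h hS) hT
  · exact bot_le
  · exact le_rfl

theorem Finset.sup_inf_sup_of_antitone {ι L : Type*} [LinearOrder ι]
    [DistribLattice L] [OrderBot L] (s : Finset ι) {a a' b : ι → L}
    (ha : Antitone a) (ha' : Antitone a') :
    s.sup (fun i => a i ⊓ b i) ⊓ s.sup (fun i => a' i ⊓ b i) =
      s.sup (fun i => (a i ⊓ a' i) ⊓ b i) := by
  apply le_antisymm
  · rw [Finset.sup_inf_distrib_right]
    refine Finset.sup_le fun i hi => ?_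
    rw [Finset.sup_inf_distrib_left]
    refine Finset.sup_le fun j hj => ?_
    rcases le_total i j with h | h
    · refine le_trans ?_ (Finset.le_sup (f := fun i => (a i ⊓ a' i) ⊓ b i) hi)
      exact le_inf (le_inf (inf_le_left.trans inf_le_left)
        ((inf_le_right.trans inf_le_left).trans (ha' h))) (inf_le_left.trans inf_le_right)
    · refine le_trans ?_ (Finset.le_sup (f := fun i => (a i ⊓ a' i) ⊓ b i) hj)
      exact le_inf (le_inf ((inf_le_left.trans inf_le_left).trans (ha h))
        (inf_le_right.trans inf_le_left)) (inf_le_right.trans inf_le_right)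
  · exact le_inf (Finset.sup_mono_fun fun i _ => inf_le_inf_right _ inf_le_left)
      (Finset.sup_mono_fun fun i _ => inf_le_inf_right _ inf_le_right)

/-- Representation theorem (disjunctive form on an ordered simplex). On a bounded
chain, if `x_{σ(1)} ≤ ⋯ ≤ x_{σ(n)}`, then
`p x = ⋁_{i=1}^{n+1} (α_p (S_σ(i)) ⊓ x_{σ(i)})`, where `S_σ(i) = {σ(i), …, σ(n)}`,
`S_σ(n+1) = ∅`, `x_{σ(n+1)} = 1`, and `α_p S = p (e_S)`.
(Here indices `i : Fin (n+1)` correspond to the paper's indices `i+1 ∈ {1, …, n+1}`.) -/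
theorem wlp_representation_sup_on_simplex
    {L : Type*} [LinearOrder L] [BoundedOrder L] {n : ℕ} (hn : 1 ≤ n)
    (p : (Fin n → L) → L) (hp : IsWLP p)
    (σ : Equiv.Perm (Fin n)) (x : Fin n → L)
    (hx : ∀ i j : Fin n, i ≤ j → x (σ i) ≤ x (σ j)) :
    p x = Finset.univ.sup (fun i : Fin (n + 1) =>
      p (charVec L ((Finset.univ.filter (fun j : Fin n => (i : ℕ) ≤ (j : ℕ))).image σ)) ⊓
      (if h : (i : ℕ) < n then x (σ ⟨i, h⟩) else ⊤)) := by
  have hS : Antitone fun i : Fin (n + 1) => charVec L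
      ((Finset.univ.filter (fun j : Fin n => (i : ℕ) ≤ (j : ℕ))).image σ) := by
    refine charVec_mono.comp_antitone fun i j hij => Finset.image_subset_image ?_
    exact Finset.monotone_filter_right _ fun _ _ h => le_trans (Fin.le_def.mp hij) h
  have hb : Monotone fun i : Fin (n + 1) =>
      if h : (i : ℕ) < n then x (σ ⟨i, h⟩) else (⊤ : L) := by
    intro i j hij
    have hij' : (i : ℕ) ≤ j := hij
    dsimp only
    split_ifs with hi hj
    · exact hx _ _ hij'
    · exact le_top
    · omega
    · exact le_rfl
  induction hp with
  | proj k =>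
    obtain ⟨m, rfl⟩ := σ.surjective k
    apply le_antisymm
    · refine le_trans ?_ (Finset.le_sup (Finset.mem_univ m.castSucc))
      simp [charVec]
    · refine Finset.sup_le fun i _ => ?_
      by_cases him : (i : ℕ) ≤ m
      · exact inf_le_right.trans ((hb (show i ≤ m.castSucc from him)).trans (by simp))
      · simp [charVec, him]
  | const c =>
    apply le_antisymm
    · refine le_trans ?_ (Finset.le_sup (Finset.mem_univ (Fin.last n)))
      simp
    · exact Finset.sup_le fun i _ => inf_le_left
  | inf hp hq ihp ihq =>
    beta_reduce
    rw [ihp, ihq]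
    exact Finset.sup_inf_sup_of_antitone _ (hp.monotone.comp_antitone hS)
      (hq.monotone.comp_antitone hS)
  | sup hp hq ihp ihq =>
    beta_reduce
    rw [ihp, ihq, ← Finset.sup_sup]
    exact Finset.sup_congr rfl fun i _ => (inf_sup_right _ _ _).symm
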